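/- arXiv:1906.04733 — 2 statements merged into one kernel-verified Lean document; each statement's English description precedes it below -/
import Mathlib

section
/- For every function ν : S × A → ℝ, J(ν) + (1/2) Σ_{(s,a)} d^D(s,a) w(s,a)² = (1/2) Σ_{(s,a)} d^D(s,a) ((ν − B^π ν)(s,a) − w(s,a))². In particular J(ν) − min_ν' J(ν') equals one half of the d^D-weighted squared L² distance between the Bellman residual of ν and the stationary distribution correction w. -/
open scoped BigOperators

/-- The t-step state distributions: `betaT T pi beta 0 = beta` and
`betaT T pi beta (t+1) s' = ∑ s, ∑ a, betaT T pi beta t s * pi s a * T s a s'`. -/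
def betaT {S A : Type*} [Fintype S] [Fintype A]
    (T : S → A → S → ℝ) (pi : S → A → ℝ) (beta : S → ℝ) : ℕ → S → ℝ
  | 0 => beta
  | t + 1 => fun s' => ∑ s, ∑ a, betaT T pi beta t s * pi s a * T s a s'

/-- The discounted occupancy `d^π(s,a) = (1−γ) ∑_t γ^t β_t(s) π(a|s)`. -/
noncomputable def dPi {S A : Type*} [Fintype S] [Fintype A]
    (γ : ℝ) (T : S → A → S → ℝ) (pi : S → A → ℝ) (beta : S → ℝ) (s : S) (a : A) : ℝ :=
  (1 - γ) * ∑' t : ℕ, γ ^ t * betaT T pi beta t s * pi s a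


/-- The (reward-free) expected Bellman operator
`(B^π ν)(s,a) = γ ∑_{s'} T(s'|s,a) ∑_{a'} π(a'|s') ν(s',a')`. -/
noncomputable def Bpi {S A : Type*} [Fintype S] [Fintype A]
    (γ : ℝ) (T : S → A → S → ℝ) (pi : S → A → ℝ) (ν : S → A → ℝ) (s : S) (a : A) : ℝ :=
  γ * ∑ s', T s a s' * ∑ a', pi s' a' * ν s' a'

theorem betaT_nonneg_aux {S A : Type*} [Fintype S] [Fintype A]
    (T : S → A → S → ℝ) (pi : S → A → ℝ) (beta : S → ℝ)
    (hT0 : ∀ s a s', 0 ≤ T s a s') (hpi0 : ∀ s a, 0 ≤ pi s a)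
    (hbeta0 : ∀ s, 0 ≤ beta s) (t : ℕ) : ∀ s, 0 ≤ betaT T pi beta t s := by
  induction t with
  | zero => exact hbeta0
  | succ t ih =>
    intro s'
    exact Finset.sum_nonneg fun s _ => Finset.sum_nonneg fun a _ =>
      mul_nonneg (mul_nonneg (ih s) (hpi0 s a)) (hT0 s a s')

theorem betaT_sum_aux {S A : Type*} [Fintype S] [Fintype A]
    (T : S → A → S → ℝ) (pi : S → A → ℝ) (beta : S → ℝ)
    (hT1 : ∀ s a, ∑ s', T s a s' = 1) (hpi1 : ∀ s, ∑ a, pi s a = 1)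
    (hbeta1 : ∑ s, beta s = 1) (t : ℕ) : ∑ s, betaT T pi beta t s = 1 := by
  induction t with
  | zero => exact hbeta1
  | succ t ih =>
    show ∑ s', ∑ s, ∑ a, betaT T pi beta t s * pi s a * T s a s' = 1
    rw [Finset.sum_comm, ← ih]
    refine Finset.sum_congr rfl fun s _ => ?_
    rw [Finset.sum_comm]
    simp_rw [← Finset.mul_sum, hT1, mul_one]
    rw [← Finset.mul_sum, hpi1, mul_one]

theorem summable_aux {S A : Type*} [Fintype S] [Fintype A]
    (T : S → A → S → ℝ) (pi : S → A → ℝ) (beta : S → ℝ) (γ : ℝ)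
    (hT0 : ∀ s a s', 0 ≤ T s a s') (hT1 : ∀ s a, ∑ s', T s a s' = 1)
    (hpi0 : ∀ s a, 0 ≤ pi s a) (hpi1 : ∀ s, ∑ a, pi s a = 1)
    (hbeta0 : ∀ s, 0 ≤ beta s) (hbeta1 : ∑ s, beta s = 1)
    (hγ0 : 0 ≤ γ) (hγ1 : γ < 1) (s : S) :
    Summable fun t : ℕ => γ ^ t * betaT T pi beta t s := by
  have h0 := betaT_nonneg_aux T pi beta hT0 hpi0 hbeta0
  refine Summable.of_nonneg_of_le (fun t => mul_nonneg (pow_nonneg hγ0 t) (h0 t s))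
    (fun t => ?_) (summable_geometric_of_lt_one hγ0 hγ1)
  refine mul_le_of_le_one_right (pow_nonneg hγ0 t) ?_
  rw [← betaT_sum_aux T pi beta hT1 hpi1 hbeta1 t]
  exact Finset.single_le_sum (f := fun s => betaT T pi beta t s)
    (fun i _ => h0 t i) (Finset.mem_univ s)

theorem flow_aux {S A : Type*} [Fintype S] [Fintype A]
    (T : S → A → S → ℝ) (pi : S → A → ℝ) (beta : S → ℝ) (γ : ℝ)
    (hs : ∀ s, Summable fun t : ℕ => γ ^ t * betaT T pi beta t s) (s' : S) :
    ∑' t : ℕ, γ ^ t * betaT T pi beta t s' = beta s' +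
      γ * ∑ s, ∑ a, (∑' t : ℕ, γ ^ t * betaT T pi beta t s) * pi s a * T s a s' := by
  rw [(hs s').tsum_eq_zero_add]
  congr 1
  · simp [betaT]
  · have h : HasSum (fun t : ℕ => γ * ∑ s, ∑ a,
        (γ ^ t * betaT T pi beta t s) * pi s a * T s a s')
        (γ * ∑ s, ∑ a, (∑' t : ℕ, γ ^ t * betaT T pi beta t s) * pi s a * T s a s') :=
      (hasSum_sum fun s _ => hasSum_sum fun a _ =>
        (((hs s).hasSum.mul_right _).mul_right _)).mul_left γ
    rw [← h.tsum_eq]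
    refine tsum_congr fun t => ?_
    simp only [betaT, Finset.mul_sum]
    refine Finset.sum_congr rfl fun s _ => Finset.sum_congr rfl fun a _ => ?_
    ring

theorem key_aux {S A : Type*} [Fintype S] [Fintype A]
    (T : S → A → S → ℝ) (pi : S → A → ℝ) (beta : S → ℝ) (γ : ℝ)
    (hs : ∀ s, Summable fun t : ℕ => γ ^ t * betaT T pi beta t s) (ν : S → A → ℝ) :
    ∑ s, ∑ a, dPi γ T pi beta s a * (ν s a - Bpi γ T pi ν s a) =
      (1 - γ) * ∑ s, ∑ a, beta s * pi s a * ν s a := by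
  have hf := flow_aux T pi beta γ hs
  have hd : ∀ s a, dPi γ T pi beta s a =
      (1 - γ) * ((∑' t : ℕ, γ ^ t * betaT T pi beta t s) * pi s a) := by
    intro s a
    rw [dPi, tsum_mul_right]
  obtain ⟨G, hG⟩ : ∃ G : S → ℝ, G = fun s => ∑' t : ℕ, γ ^ t * betaT T pi beta t s := ⟨_, rfl⟩
  have hG1 : ∀ s, ∑' t : ℕ, γ ^ t * betaT T pi beta t s = G s := fun s => by rw [hG]
  simp only [hG1] at hf hd
  have hB : ∑ s, ∑ a, G s * pi s a * Bpi γ T pi ν s a =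
      ∑ s', (γ * ∑ s, ∑ a, G s * pi s a * T s a s') * ∑ a', pi s' a' * ν s' a' := by
    have h1 : ∀ s a, G s * pi s a * Bpi γ T pi ν s a =
        ∑ s', γ * (G s * pi s a * T s a s') * ∑ a', pi s' a' * ν s' a' := by
      intro s a
      rw [Bpi, Finset.mul_sum, Finset.mul_sum]
      refine Finset.sum_congr rfl fun s' _ => ?_
      ring
    simp_rw [h1]
    rw [Finset.sum_congr rfl fun s _ => Finset.sum_comm, Finset.sum_comm]
    refine Finset.sum_congr rfl fun s' _ => ?_
    generalize (∑ a', pi s' a' * ν s' a') = c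
    simp only [Finset.mul_sum, Finset.sum_mul]
  have hV : ∑ s, ∑ a, G s * pi s a * ν s a = ∑ s, G s * ∑ a, pi s a * ν s a := by
    simp only [Finset.mul_sum, mul_assoc]
  have hb : ∑ s, ∑ a, beta s * pi s a * ν s a = ∑ s, beta s * ∑ a, pi s a * ν s a := by
    simp only [Finset.mul_sum, mul_assoc]
  have hL : ∑ s, ∑ a, dPi γ T pi beta s a * (ν s a - Bpi γ T pi ν s a) =
      (1 - γ) * (∑ s, ∑ a, G s * pi s a * ν s a
        - ∑ s, ∑ a, G s * pi s a * Bpi γ T pi ν s a) := by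
    simp only [hd, ← Finset.sum_sub_distrib, Finset.mul_sum]
    refine Finset.sum_congr rfl fun s _ => Finset.sum_congr rfl fun a _ => ?_
    ring
  rw [hL, hB, hV, hb, ← Finset.sum_sub_distrib]
  congr 1
  refine Finset.sum_congr rfl fun s _ => ?_
  rw [← sub_mul]
  congr 1
  linarith [hf s]

theorem J_suboptimality_identity
    {S A : Type*} [Fintype S] [Fintype A] [Nonempty S] [Nonempty A]
    (T : S → A → S → ℝ) (pi : S → A → ℝ) (beta : S → ℝ) (γ : ℝ) (dD : S → A → ℝ)
    (hT0 : ∀ s a s', 0 ≤ T s a s') (hT1 : ∀ s a, ∑ s', T s a s' = 1)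
    (hpi0 : ∀ s a, 0 ≤ pi s a) (hpi1 : ∀ s, ∑ a, pi s a = 1)
    (hbeta0 : ∀ s, 0 ≤ beta s) (hbeta1 : ∑ s, beta s = 1)
    (hγ0 : 0 ≤ γ) (hγ1 : γ < 1)
    (hdD0 : ∀ s a, 0 < dD s a) (hdD1 : ∑ s, ∑ a, dD s a = 1)
    (w : S → A → ℝ) (hw : ∀ s a, w s a = dPi γ T pi beta s a / dD s a)
    (J : (S → A → ℝ) → ℝ)
    (hJ : ∀ ν : S → A → ℝ,
      J ν = (1 / 2) * (∑ s, ∑ a, dD s a * (ν s a - Bpi γ T pi ν s a) ^ 2)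
              - (1 - γ) * ∑ s, ∑ a, beta s * pi s a * ν s a) :
    ∀ ν : S → A → ℝ,
      J ν + (1 / 2) * (∑ s, ∑ a, dD s a * (w s a) ^ 2) =
        (1 / 2) * ∑ s, ∑ a, dD s a * ((ν s a - Bpi γ T pi ν s a) - w s a) ^ 2 := by
  intro ν
  have key := key_aux T pi beta γ
    (summable_aux T pi beta γ hT0 hT1 hpi0 hpi1 hbeta0 hbeta1 hγ0 hγ1) ν
  rw [hJ, ← key]
  simp only [Finset.mul_sum]
  rw [← Finset.sum_sub_distrib, ← Finset.sum_add_distrib]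
  refine Finset.sum_congr rfl fun s _ => ?_
  rw [← Finset.sum_sub_distrib, ← Finset.sum_add_distrib]
  refine Finset.sum_congr rfl fun a _ => ?_
  have h : dPi γ T pi beta s a = dD s a * w s a := by
    rw [hw, mul_div_cancel₀]; exact (hdD0 s a).ne'
  rw [h]
  ring
end

section
/- Let f : ℝ → ℝ be differentiable and strictly convex with derivative f' : ℝ → ℝ surjective. Then the objective J^f(ν) = Σ_{(s,a)} d^D(s,a) f((ν − B^π ν)(s,a)) − (1−γ) Σ_{s∈S} Σ_{a∈A} β(s) π(a|s) ν(s,a) has a unique minimizer ν* over all functions ν : S × A → ℝ, and it satisfies f'((ν* − B^π ν*)(s,a)) = w(s,a) for every (s,a) ∈ S × A. -/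
open scoped BigOperators

theorem aux_tangent (f : ℝ → ℝ) (hf : Differentiable ℝ f) (hconv : StrictConvexOn ℝ Set.univ f)
    (x y : ℝ) (h : y ≠ x) : f x + deriv f x * (y - x) < f y := by
  rcases lt_or_gt_of_ne h with h | h
  · have := hconv.slope_lt_of_hasDerivAt (Set.mem_univ y) (Set.mem_univ x) h (hf x).hasDerivAt
    rw [slope_def_field, div_lt_iff₀ (by linarith)] at this
    linarith
  · have := hconv.lt_slope_of_hasDerivAt (Set.mem_univ x) (Set.mem_univ y) h (hf x).hasDerivAt
    rw [slope_def_field, lt_div_iff₀ (by linarith)] at this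
    linarith

theorem aux_betaT {S A : Type*} [Fintype S] [Fintype A]
    (T : S → A → S → ℝ) (pi : S → A → ℝ) (beta : S → ℝ)
    (hT0 : ∀ s a s', 0 ≤ T s a s') (hT1 : ∀ s a, ∑ s', T s a s' = 1)
    (hpi0 : ∀ s a, 0 ≤ pi s a) (hpi1 : ∀ s, ∑ a, pi s a = 1)
    (hbeta0 : ∀ s, 0 ≤ beta s) (hbeta1 : ∑ s, beta s = 1) (t : ℕ) :
    (∀ s, 0 ≤ betaT T pi beta t s) ∧ ∑ s, betaT T pi beta t s = 1 := by
  induction t with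
  | zero => exact ⟨hbeta0, hbeta1⟩
  | succ t ih =>
    refine ⟨fun s' => ?_, ?_⟩
    · exact Finset.sum_nonneg fun s _ => Finset.sum_nonneg fun a _ =>
        mul_nonneg (mul_nonneg (ih.1 s) (hpi0 s a)) (hT0 s a s')
    · simp only [betaT]
      rw [Finset.sum_comm, ← ih.2]
      refine Finset.sum_congr rfl fun s _ => ?_
      rw [Finset.sum_comm]
      simp only [← Finset.mul_sum, hT1, hpi1, mul_one]

theorem aux_occ {S A : Type*} [Fintype S] [Fintype A]
    (T : S → A → S → ℝ) (pi : S → A → ℝ) (beta : S → ℝ) (γ : ℝ)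
    (hT0 : ∀ s a s', 0 ≤ T s a s') (hT1 : ∀ s a, ∑ s', T s a s' = 1)
    (hpi0 : ∀ s a, 0 ≤ pi s a) (hpi1 : ∀ s, ∑ a, pi s a = 1)
    (hbeta0 : ∀ s, 0 ≤ beta s) (hbeta1 : ∑ s, beta s = 1)
    (hγ0 : 0 ≤ γ) (hγ1 : γ < 1) (ν : S → A → ℝ) :
    ∑ s, ∑ a, dPi γ T pi beta s a * (ν s a - Bpi γ T pi ν s a)
      = (1 - γ) * ∑ s, ∑ a, beta s * pi s a * ν s a := by
  have hb := aux_betaT T pi beta hT0 hT1 hpi0 hpi1 hbeta0 hbeta1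
  have hsum : ∀ s, Summable fun t : ℕ => γ ^ t * betaT T pi beta t s := by
    intro s
    refine Summable.of_nonneg_of_le (fun t => mul_nonneg (pow_nonneg hγ0 t) ((hb t).1 s))
      (fun t => ?_) (summable_geometric_of_lt_one hγ0 hγ1)
    refine mul_le_of_le_one_right (pow_nonneg hγ0 t) ?_
    rw [← (hb t).2]
    exact Finset.single_le_sum (fun i _ => (hb t).1 i) (Finset.mem_univ s)
  obtain ⟨D, hD⟩ : ∃ D : S → ℝ, ∀ s, HasSum (fun t : ℕ => γ ^ t * betaT T pi beta t s) (D s) :=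
    ⟨_, fun s => (hsum s).hasSum⟩
  have hd : ∀ s a, dPi γ T pi beta s a = (1 - γ) * (D s * pi s a) := by
    intro s a
    rw [dPi, ((hD s).mul_right (pi s a)).tsum_eq]
  have hrec : ∀ s', D s' = beta s' + γ * ∑ s, ∑ a, D s * pi s a * T s a s' := by
    intro s'
    have h1 := (hasSum_nat_add_iff' 1).mpr (hD s')
    have h2 : HasSum (fun t : ℕ => γ * ∑ s, ∑ a, γ ^ t * betaT T pi beta t s * pi s a * T s a s')
        (γ * ∑ s, ∑ a, D s * pi s a * T s a s') :=
      HasSum.mul_left _ (hasSum_sum fun s _ => hasSum_sum fun a _ =>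
        ((hD s).mul_right _).mul_right _)
    have h3 : (fun t : ℕ => γ ^ (t+1) * betaT T pi beta (t+1) s') =
        (fun t : ℕ => γ * ∑ s, ∑ a, γ ^ t * betaT T pi beta t s * pi s a * T s a s') := by
      funext t
      simp only [betaT, Finset.mul_sum]
      refine Finset.sum_congr rfl fun s _ => Finset.sum_congr rfl fun a _ => ?_
      ring
    rw [h3] at h1
    have := h1.unique h2
    simp [betaT] at this
    linarith
  have e1 : ∑ s, ∑ a, D s * pi s a * Bpi γ T pi ν s a
      = ∑ s', (γ * ∑ s, ∑ a, D s * pi s a * T s a s') * ∑ a', pi s' a' * ν s' a' := by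
    simp only [Bpi]
    generalize hV : (fun s' => ∑ a', pi s' a' * ν s' a') = V
    have hV' : ∀ s', ∑ a', pi s' a' * ν s' a' = V s' := fun s' => congrFun hV s'
    simp only [hV', Finset.mul_sum, Finset.sum_mul]
    rw [Finset.sum_comm (f := fun s' s => ∑ a, γ * (D s * pi s a * T s a s') * V s')]
    refine Finset.sum_congr rfl fun s _ => ?_
    rw [Finset.sum_comm]
    refine Finset.sum_congr rfl fun s' _ => Finset.sum_congr rfl fun a _ => ?_
    ring
  have e2 : ∑ s, ∑ a, D s * pi s a * ν s a
      = ∑ s', D s' * ∑ a', pi s' a' * ν s' a' := by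
    simp only [Finset.mul_sum, mul_assoc]
  have e3 : ∑ s, ∑ a, beta s * pi s a * ν s a
      = ∑ s', beta s' * ∑ a', pi s' a' * ν s' a' := by
    simp only [Finset.mul_sum, mul_assoc]
  have e4 : ∑ s, ∑ a, D s * pi s a * ν s a - ∑ s, ∑ a, D s * pi s a * Bpi γ T pi ν s a
      = ∑ s, ∑ a, beta s * pi s a * ν s a := by
    rw [e1, e2, e3, ← Finset.sum_sub_distrib]
    refine Finset.sum_congr rfl fun s _ => ?_
    rw [← sub_mul]
    congr 1
    linarith [hrec s]
  rw [← e4]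
  simp only [← Finset.sum_sub_distrib, Finset.mul_sum, hd]
  refine Finset.sum_congr rfl fun s _ => Finset.sum_congr rfl fun a _ => ?_
  ring

theorem aux_inj {S A : Type*} [Fintype S] [Fintype A]
    (T : S → A → S → ℝ) (pi : S → A → ℝ) (γ : ℝ)
    (hT0 : ∀ s a s', 0 ≤ T s a s') (hT1 : ∀ s a, ∑ s', T s a s' = 1)
    (hpi0 : ∀ s a, 0 ≤ pi s a) (hpi1 : ∀ s, ∑ a, pi s a = 1)
    (hγ0 : 0 ≤ γ) (hγ1 : γ < 1) (ν : S → A → ℝ)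
    (h : ∀ s a, ν s a = Bpi γ T pi ν s a) : ν = 0 := by
  have hn : ∀ s a, |ν s a| ≤ ‖ν‖ := fun s a =>
    (norm_le_pi_norm (ν s) a).trans (norm_le_pi_norm ν s)
  have h1 : ∀ s, |∑ a, pi s a * ν s a| ≤ ‖ν‖ := by
    intro s
    calc _ ≤ ∑ a, |pi s a * ν s a| := Finset.abs_sum_le_sum_abs _ _
      _ ≤ ∑ a, pi s a * ‖ν‖ := Finset.sum_le_sum fun a _ => by
          rw [abs_mul, abs_of_nonneg (hpi0 s a)]
          exact mul_le_mul_of_nonneg_left (hn s a) (hpi0 s a)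
      _ = _ := by rw [← Finset.sum_mul, hpi1, one_mul]
  have h2 : ∀ s a, |ν s a| ≤ γ * ‖ν‖ := by
    intro s a
    rw [h s a, Bpi, abs_mul, abs_of_nonneg hγ0]
    refine mul_le_mul_of_nonneg_left ?_ hγ0
    calc _ ≤ ∑ s', |T s a s' * ∑ a', pi s' a' * ν s' a'| := Finset.abs_sum_le_sum_abs _ _
      _ ≤ ∑ s', T s a s' * ‖ν‖ := Finset.sum_le_sum fun s' _ => by
          rw [abs_mul, abs_of_nonneg (hT0 s a s')]
          exact mul_le_mul_of_nonneg_left (h1 s') (hT0 s a s')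
      _ = _ := by rw [← Finset.sum_mul, hT1, one_mul]
  have h0 : 0 ≤ γ * ‖ν‖ := mul_nonneg hγ0 (norm_nonneg _)
  have h3 : ‖ν‖ ≤ γ * ‖ν‖ :=
    (pi_norm_le_iff_of_nonneg h0).2 fun s => (pi_norm_le_iff_of_nonneg h0).2 fun a => h2 s a
  have h4 : ‖ν‖ ≤ 0 := by nlinarith [norm_nonneg ν]
  exact norm_le_zero_iff.1 h4

/-- The linear map `ν ↦ ν - B ν`. -/
noncomputable def auxL {S A : Type*} [Fintype S] [Fintype A]
    (T : S → A → S → ℝ) (pi : S → A → ℝ) (γ : ℝ) : (S → A → ℝ) →ₗ[ℝ] (S → A → ℝ) where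
  toFun ν := fun s a => ν s a - Bpi γ T pi ν s a
  map_add' x y := by
    funext s a
    simp only [Bpi, Pi.add_apply, mul_add, Finset.sum_add_distrib]
    ring
  map_smul' c x := by
    funext s a
    simp only [Bpi, Pi.smul_apply, smul_eq_mul, RingHom.id_apply, mul_sub, Finset.mul_sum]
    congr 1
    refine Finset.sum_congr rfl fun s _ => Finset.sum_congr rfl fun a _ => ?_
    ring

theorem Jf_unique_minimizer_residual
    {S A : Type*} [Fintype S] [Fintype A] [Nonempty S] [Nonempty A]
    (T : S → A → S → ℝ) (pi : S → A → ℝ) (beta : S → ℝ) (γ : ℝ) (dD : S → A → ℝ)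
    (hT0 : ∀ s a s', 0 ≤ T s a s') (hT1 : ∀ s a, ∑ s', T s a s' = 1)
    (hpi0 : ∀ s a, 0 ≤ pi s a) (hpi1 : ∀ s, ∑ a, pi s a = 1)
    (hbeta0 : ∀ s, 0 ≤ beta s) (hbeta1 : ∑ s, beta s = 1)
    (hγ0 : 0 ≤ γ) (hγ1 : γ < 1)
    (hdD0 : ∀ s a, 0 < dD s a) (hdD1 : ∑ s, ∑ a, dD s a = 1)
    (w : S → A → ℝ) (hw : ∀ s a, w s a = dPi γ T pi beta s a / dD s a)
    (f : ℝ → ℝ) (hf : Differentiable ℝ f) (hconv : StrictConvexOn ℝ Set.univ f)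
    (hsurj : Function.Surjective (deriv f))
    (Jf : (S → A → ℝ) → ℝ)
    (hJf : ∀ ν : S → A → ℝ,
      Jf ν = (∑ s, ∑ a, dD s a * f (ν s a - Bpi γ T pi ν s a))
               - (1 - γ) * ∑ s, ∑ a, beta s * pi s a * ν s a) :
    ∃ νstar : S → A → ℝ,
      (∀ ν : S → A → ℝ, Jf νstar ≤ Jf ν) ∧
      (∀ ν' : S → A → ℝ, (∀ ν : S → A → ℝ, Jf ν' ≤ Jf ν) → ν' = νstar) ∧
      (∀ s a, deriv f (νstar s a - Bpi γ T pi νstar s a) = w s a) := by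
  have hLinj : Function.Injective (auxL T pi γ) := by
    rw [injective_iff_map_eq_zero]
    intro ν h
    refine aux_inj T pi γ hT0 hT1 hpi0 hpi1 hγ0 hγ1 ν fun s a => ?_
    exact sub_eq_zero.1 (congrFun (congrFun h s) a)
  have hLsurj := LinearMap.injective_iff_surjective.1 hLinj
  choose x hx using fun s a => hsurj (w s a)
  obtain ⟨νs, hνs⟩ := hLsurj x
  have hJ : ∀ ν, Jf ν = ∑ s, ∑ a, dD s a * (f (auxL T pi γ ν s a) - w s a * auxL T pi γ ν s a) := by
    intro ν
    rw [hJf, ← aux_occ T pi beta γ hT0 hT1 hpi0 hpi1 hbeta0 hbeta1 hγ0 hγ1]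
    simp only [← Finset.sum_sub_distrib]
    refine Finset.sum_congr rfl fun s _ => Finset.sum_congr rfl fun a _ => ?_
    have : dPi γ T pi beta s a = dD s a * w s a := by
      rw [hw]; field_simp [(hdD0 s a).ne']
    rw [this]
    simp only [auxL, LinearMap.coe_mk, AddHom.coe_mk]
    ring
  have hle : ∀ s a y, dD s a * (f (x s a) - w s a * x s a) ≤ dD s a * (f y - w s a * y) := by
    intro s a y
    refine mul_le_mul_of_nonneg_left ?_ (hdD0 s a).le
    by_cases h : y = x s a
    · rw [h]
    · have := aux_tangent f hf hconv _ _ h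
      rw [hx] at this
      linarith
  have hlt : ∀ s a y, y ≠ x s a →
      dD s a * (f (x s a) - w s a * x s a) < dD s a * (f y - w s a * y) := by
    intro s a y h
    refine mul_lt_mul_of_pos_left ?_ (hdD0 s a)
    have := aux_tangent f hf hconv _ _ h
    rw [hx] at this
    linarith
  refine ⟨νs, fun ν => ?_, fun ν' hν' => ?_, fun s a => ?_⟩
  · rw [hJ, hJ, hνs]
    exact Finset.sum_le_sum fun s _ => Finset.sum_le_sum fun a _ => hle s a _
  · apply hLinj
    rw [hνs]
    by_contra hne
    have : ∃ s a, auxL T pi γ ν' s a ≠ x s a := by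
      by_contra! hc
      exact hne (funext fun s => funext fun a => hc s a)
    obtain ⟨s, a, hsa⟩ := this
    have h1 := hν' νs
    rw [hJ, hJ νs, hνs] at h1
    refine absurd h1 (not_le.2 ?_)
    refine Finset.sum_lt_sum (fun s _ => Finset.sum_le_sum fun a _ => hle s a _)
      ⟨s, Finset.mem_univ s, ?_⟩
    exact Finset.sum_lt_sum (fun a _ => hle s a _) ⟨a, Finset.mem_univ a, hlt s a _ hsa⟩
  · rw [← hx s a, ← hνs]
    rfl
end
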